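/- arXiv:1706.01928 — 2 statements merged into one kernel-verified Lean document; each statement's English description precedes it below -/
import Mathlib

section
/- Let ν ≥ 0, α > 0, y > 0, and let s be a real number with s > 0 and s > ν − 1. Then ∫₀^y (y² − x²)^{2α−1} ₂F₁(α + (ν−1)/2, α; 2α; 1 − x²/y²) x^{s−1} dx = (y^{4α+s−2}/2) · [Γ(2α) · Γ(s/2) · Γ((s − ν + 1)/2)] / [Γ(α + (s − ν + 1)/2) · Γ(α + s/2)]. -/
open MeasureTheory Set

/-- Gauss hypergeometric function ₂F₁(a,b;c;z) defined by its power series. -/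
noncomputable def gaussHyp (a b c z : ℝ) : ℝ :=
  ∑' n : ℕ, ((ascPochhammer ℝ n).eval a * (ascPochhammer ℝ n).eval b /
    ((ascPochhammer ℝ n).eval c * (n.factorial : ℝ))) * z ^ n

lemma aux_beta_ii {p q : ℝ} (hp : 0 < p) (hq : 0 < q) :
    IntegrableOn (fun t : ℝ => t ^ (p - 1) * (1 - t) ^ (q - 1)) (Ioo 0 1) ∧
    ∫ t in Ioo (0 : ℝ) 1, t ^ (p - 1) * (1 - t) ^ (q - 1) =
      Real.Gamma p * Real.Gamma q / Real.Gamma (p + q) := by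
  have hc := Complex.betaIntegral_convergent (u := p) (v := q) (by simpa) (by simpa)
  have hv := Complex.betaIntegral_eq_Gamma_mul_div p q (by simpa) (by simpa)
  rw [Complex.betaIntegral, intervalIntegral.integral_of_le zero_le_one,
    integral_Ioc_eq_integral_Ioo] at hv
  rw [intervalIntegrable_iff_integrableOn_Ioo_of_le zero_le_one] at hc
  have he : EqOn (fun x : ℝ => (x : ℂ) ^ ((p : ℂ) - 1) * (1 - (x : ℂ)) ^ ((q : ℂ) - 1))
      (fun t : ℝ => ((t ^ (p - 1) * (1 - t) ^ (q - 1) : ℝ) : ℂ)) (Ioo 0 1) := by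
    intro x hx
    have h1 : 0 ≤ 1 - x := by linarith [hx.2]
    simp only []
    push_cast
    rw [Complex.ofReal_cpow hx.1.le, Complex.ofReal_cpow h1]
    push_cast
    rfl
  rw [integrableOn_congr_fun he measurableSet_Ioo] at hc
  rw [setIntegral_congr_fun measurableSet_Ioo he, integral_complex_ofReal] at hv
  constructor
  · have := hc.re
    simp only [RCLike.re_to_complex, Complex.ofReal_re] at this
    exact this
  · apply Complex.ofReal_injective
    rw [hv, ← Complex.ofReal_add, Complex.Gamma_ofReal, Complex.Gamma_ofReal,
      Complex.Gamma_ofReal]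
    push_cast
    rfl

lemma aux_gamma {x : ℝ} (hx : 0 < x) (n : ℕ) :
    Real.Gamma (x + n) = (ascPochhammer ℝ n).eval x * Real.Gamma x := by
  induction n with
  | zero => simp
  | succ n ih =>
    rw [ascPochhammer_succ_eval, Nat.cast_succ, ← add_assoc,
      Real.Gamma_add_one (by positivity), ih]
    ring

lemma aux_summable {a b C : ℝ} (hb : 0 < b) (hC : 0 < C) (h : a + b < C) :
    Summable (fun n : ℕ => |(ascPochhammer ℝ n).eval a| * (ascPochhammer ℝ n).eval b /
      ((ascPochhammer ℝ n).eval C * (n.factorial : ℝ))) := by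
  set T : ℕ → ℝ := fun n : ℕ => |(ascPochhammer ℝ n).eval a| * (ascPochhammer ℝ n).eval b /
      ((ascPochhammer ℝ n).eval C * (n.factorial : ℝ)) with hT
  have hT0 : ∀ n, 0 ≤ T n := by
    intro n
    have h1 := ascPochhammer_pos n b hb
    have h2 := ascPochhammer_pos n C hC
    simp only [hT]
    positivity
  have hstep : ∀ n : ℕ, T (n + 1) * ((C + n) * (n + 1)) = T n * (|a + n| * (b + n)) := by
    intro n
    have h2 := ascPochhammer_pos n C hC
    have h3 : 0 < C + n := by positivity
    have h4 : (0 : ℝ) < n.factorial := by positivity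
    simp only [hT, ascPochhammer_succ_eval, abs_mul, Nat.factorial_succ]
    push_cast
    field_simp
  set d := C - a - b with hd
  have hd0 : 0 < d := by linarith
  obtain ⟨N, hN⟩ := exists_nat_ge (|a| + (d / 2 * C + |a * b|) / (d / 2))
  rw [← summable_nat_add_iff N]
  have hkey : ∀ n : ℕ, N ≤ n → d / 2 * T n ≤ n * T n - (n + 1) * T (n + 1) := by
    intro n hn
    have hn' : (N : ℝ) ≤ n := by exact_mod_cast hn
    have h3 : 0 < C + n := by positivity
    have e1 : 0 ≤ (d / 2 * C + |a * b|) / (d / 2) := by positivity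
    have e2 : 0 ≤ a + n := by
      have := neg_abs_le a
      linarith
    have e3 : (d / 2 * C + |a * b|) ≤ d / 2 * n := by
      have : (d / 2 * C + |a * b|) / (d / 2) ≤ n := by
        have := abs_nonneg a
        linarith
      rw [div_le_iff₀ (by positivity)] at this
      linarith
    have e4 := le_abs_self (a * b)
    have hs := hstep n
    rw [abs_of_nonneg e2] at hs
    have : d / 2 * T n * (C + n) ≤ (n * T n - (n + 1) * T (n + 1)) * (C + n) := by
      have : (n * T n - (n + 1) * T (n + 1)) * (C + n) = T n * (d * n - a * b) := by
        rw [hd]; linear_combination -hs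
      rw [this]
      have := mul_le_mul_of_nonneg_left (show d / 2 * (C + n) ≤ d * n - a * b by linarith) (hT0 n)
      linarith
    exact le_of_mul_le_mul_right this h3
  refine summable_of_sum_range_le (c := N * T N / (d / 2)) (fun n => hT0 _) ?_
  intro m
  have hind : d / 2 * ∑ i ∈ Finset.range m, T (i + N) ≤ N * T N - (m + N : ℕ) * T (m + N) := by
    induction m with
    | zero => simp
    | succ m ih =>
      rw [Finset.sum_range_succ, mul_add]
      have := hkey (m + N) (by omega)
      rw [show m + 1 + N = m + N + 1 by ring]
      push_cast at *
      linarith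
  rw [le_div_iff₀ (by positivity)]
  have : 0 ≤ (m + N : ℕ) * T (m + N) := mul_nonneg (by positivity) (hT0 _)
  linarith

lemma aux_term {p q : ℝ} (hp : 0 < p) (hq : 0 < q) (k : ℕ → ℝ)
    (hk : Summable fun n : ℕ => |k n| *
      (Real.Gamma (p + n) * Real.Gamma q / Real.Gamma (p + n + q))) :
    ∫ t in Ioo (0 : ℝ) 1, t ^ (p - 1) * (1 - t) ^ (q - 1) * ∑' n, k n * t ^ n =
      ∑' n : ℕ, k n * (Real.Gamma (p + n) * Real.Gamma q / Real.Gamma (p + n + q)) := by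
  have hB := fun n : ℕ => aux_beta_ii (p := p + n) (q := q) (by positivity) hq
  have key := integral_tsum_of_summable_integral_norm (μ := volume.restrict (Ioo (0 : ℝ) 1))
    (F := fun (n : ℕ) t => k n * (t ^ (p + n - 1) * (1 - t) ^ (q - 1)))
    (fun n => (hB n).1.const_mul _) (by
      convert hk using 2 with n
      rw [← (hB n).2, ← integral_const_mul]
      refine setIntegral_congr_fun measurableSet_Ioo ?_
      intro t ht
      have h1 := Real.rpow_nonneg ht.1.le (p + n - 1)
      have h2 := Real.rpow_nonneg (sub_nonneg.2 ht.2.le) (q - 1)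
      simp only [Real.norm_eq_abs, abs_mul, abs_of_nonneg h1, abs_of_nonneg h2])
  simp only [integral_const_mul, (hB _).2] at key
  rw [key]
  refine setIntegral_congr_fun measurableSet_Ioo ?_
  intro t ht
  simp only []
  rw [← tsum_mul_left]
  congr 1
  ext n
  rw [show p + n - 1 = p - 1 + n by ring, Real.rpow_add ht.1, Real.rpow_natCast]
  ring

lemma aux_binom (a : ℝ) {t : ℝ} (ht : t ∈ Ioo (0 : ℝ) 1) :
    ∑' n : ℕ, (ascPochhammer ℝ n).eval a / n.factorial * t ^ n = (1 - t) ^ (-a) := by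
  have h := (Real.one_div_one_sub_rpow_hasFPowerSeriesOnBall_zero a).hasSum (y := t) (by
    simp [enorm_eq_nnnorm, ← NNReal.coe_lt_coe, abs_of_pos ht.1, ht.2])
  rw [zero_add] at h
  rw [Real.rpow_neg (by linarith [ht.2]), ← one_div, ← h.tsum_eq]
  congr 1
  ext n
  have h1 := Ring.factorial_nsmul_multichoose_eq_ascPochhammer a n
  rw [Polynomial.ascPochhammer_smeval_eq_eval] at h1
  simp only [FormalMultilinearSeries.ofScalars_apply_eq, smul_eq_mul]
  rw [Ring.choose, show a + n - 1 - n + 1 = a by ring, ← h1, nsmul_eq_mul]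
  have : (n.factorial : ℝ) ≠ 0 := by positivity
  field_simp

lemma aux_gauss {a b C : ℝ} (hb : 0 < b) (hC : b < C) (h : a + b < C) :
    ∑' n : ℕ, (ascPochhammer ℝ n).eval a * (ascPochhammer ℝ n).eval b /
      ((ascPochhammer ℝ n).eval C * (n.factorial : ℝ)) =
    Real.Gamma C * Real.Gamma (C - a - b) / (Real.Gamma (C - a) * Real.Gamma (C - b)) := by
  have hC0 : 0 < C := hb.trans hC
  have gC := Real.Gamma_pos_of_pos hC0
  have gb := Real.Gamma_pos_of_pos hb
  have gCb := Real.Gamma_pos_of_pos (sub_pos.2 hC)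
  have conv : ∀ (x : ℝ) (n : ℕ), x / n.factorial * (Real.Gamma (b + n) * Real.Gamma (C - b) /
      Real.Gamma (b + n + (C - b))) = x * (ascPochhammer ℝ n).eval b /
      ((ascPochhammer ℝ n).eval C * (n.factorial : ℝ)) *
      (Real.Gamma b * Real.Gamma (C - b) / Real.Gamma C) := by
    intro x n
    have h2 := ascPochhammer_pos n C hC0
    rw [show b + n + (C - b) = C + n by ring, aux_gamma hb, aux_gamma hC0]
    field_simp
  have key := aux_term hb (sub_pos.2 hC)
    (fun n => (ascPochhammer ℝ n).eval a / n.factorial) (by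
      have := (aux_summable hb hC0 h).mul_right
        (Real.Gamma b * Real.Gamma (C - b) / Real.Gamma C)
      refine this.congr fun n => ?_
      rw [abs_div, Nat.abs_cast, conv])
  simp only [conv] at key
  rw [tsum_mul_right] at key
  have hint : ∫ t in Ioo (0 : ℝ) 1, t ^ (b - 1) * (1 - t) ^ (C - b - 1) *
      ∑' n : ℕ, (ascPochhammer ℝ n).eval a / n.factorial * t ^ n =
      Real.Gamma b * Real.Gamma (C - a - b) / Real.Gamma (C - a) := by
    have := (aux_beta_ii hb (show 0 < C - a - b by linarith)).2
    rw [show b + (C - a - b) = C - a by ring] at this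
    rw [← this]
    refine setIntegral_congr_fun measurableSet_Ioo ?_
    intro t ht
    simp only []
    rw [aux_binom a ht, mul_assoc, ← Real.rpow_add (by linarith [ht.2])]
    ring_nf
  rw [hint] at key
  have gCa := Real.Gamma_pos_of_pos (show 0 < C - a by linarith)
  field_simp at key ⊢
  linear_combination -key

lemma aux_main {a b c q : ℝ} (hb : 0 < b) (hc : b ≤ c) (hq : 0 < q) (h : a + b < c + q) :
    ∫ t in Ioo (0 : ℝ) 1, t ^ (c - 1) * (1 - t) ^ (q - 1) * gaussHyp a b c t =
    Real.Gamma c * Real.Gamma q * Real.Gamma (c + q - a - b) /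
      (Real.Gamma (c + q - a) * Real.Gamma (c + q - b)) := by
  have hc0 : 0 < c := by linarith
  have hC0 : 0 < c + q := by linarith
  have gC := Real.Gamma_pos_of_pos hC0
  have gc := Real.Gamma_pos_of_pos hc0
  have conv : ∀ (x : ℝ) (n : ℕ), x / ((ascPochhammer ℝ n).eval c * (n.factorial : ℝ)) *
      (Real.Gamma (c + n) * Real.Gamma q /
      Real.Gamma (c + n + q)) = x /
      ((ascPochhammer ℝ n).eval (c + q) * (n.factorial : ℝ)) *
      (Real.Gamma c * Real.Gamma q / Real.Gamma (c + q)) := by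
    intro x n
    have h2 := ascPochhammer_pos n _ hC0
    have h1 := ascPochhammer_pos n _ hc0
    rw [show c + n + q = c + q + n by ring, aux_gamma hc0, aux_gamma hC0]
    field_simp
  unfold gaussHyp
  rw [aux_term hc0 hq]
  · simp only [conv]
    rw [tsum_mul_right, aux_gauss hb (by linarith) h]
    field_simp
  · have := (aux_summable hb hC0 h).mul_right
        (Real.Gamma c * Real.Gamma q / Real.Gamma (c + q))
    refine this.congr fun n => ?_
    have h1 := ascPochhammer_pos n _ hc0
    have h2 := ascPochhammer_pos n _ hb
    rw [abs_div, abs_mul, abs_of_pos h2, abs_of_pos (a := _ * (n.factorial : ℝ)) (by positivity),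
      conv]

theorem inner_integral_eval (ν α y s : ℝ) (hν : 0 ≤ ν) (hα : 0 < α) (hy : 0 < y)
    (hs : 0 < s) (hs' : ν - 1 < s) :
    ∫ x in Ioo (0 : ℝ) y, (y ^ 2 - x ^ 2) ^ (2 * α - 1) *
        gaussHyp (α + (ν - 1) / 2) α (2 * α) (1 - x ^ 2 / y ^ 2) * x ^ (s - 1) =
      (y ^ (4 * α + s - 2) / 2) *
        (Real.Gamma (2 * α) * Real.Gamma (s / 2) * Real.Gamma ((s - ν + 1) / 2)) /
        (Real.Gamma (α + (s - ν + 1) / 2) * Real.Gamma (α + s / 2)) := by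
  have hm := aux_main (a := α + (ν - 1) / 2) (b := α) (c := 2 * α) (q := s / 2) hα
    (by linarith) (by linarith) (by linarith)
  rw [show 2 * α + s / 2 - (α + (ν - 1) / 2) - α = (s - ν + 1) / 2 by ring,
    show 2 * α + s / 2 - (α + (ν - 1) / 2) = α + (s - ν + 1) / 2 by ring,
    show 2 * α + s / 2 - α = α + s / 2 by ring] at hm
  have himg : (fun x : ℝ => 1 - x ^ 2 / y ^ 2) '' Ioo 0 y = Ioo 0 1 := by
    ext t
    constructor
    · rintro ⟨x, ⟨h0, h1⟩, rfl⟩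
      have e1 : x ^ 2 / y ^ 2 < 1 := by
        rw [div_lt_one (by positivity)]
        gcongr
      have e2 : 0 < x ^ 2 / y ^ 2 := by positivity
      constructor <;> simp only [] <;> linarith
    · rintro ⟨h0, h1⟩
      have h2 : 0 < 1 - t := by linarith
      refine ⟨y * √(1 - t), ⟨by positivity, ?_⟩, ?_⟩
      · have : √(1 - t) < 1 := by
          rw [Real.sqrt_lt' one_pos]
          linarith
        nlinarith
      · simp only []
        rw [mul_pow, Real.sq_sqrt h2.le]
        field_simp
        ring
  rw [← himg, integral_image_eq_integral_abs_deriv_smul (f' := fun x => -(2 * x / y ^ 2))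
    measurableSet_Ioo] at hm
  · rw [mul_div_assoc, ← hm, ← integral_const_mul]
    refine setIntegral_congr_fun measurableSet_Ioo ?_
    rintro x ⟨h0, h1⟩
    have e0 : 0 < y ^ 2 - x ^ 2 := by nlinarith
    simp only [smul_eq_mul, sub_sub_cancel]
    rw [abs_neg, abs_of_pos (by positivity)]
    rw [show (1 : ℝ) - x ^ 2 / y ^ 2 = (y ^ 2 - x ^ 2) / y ^ 2 by field_simp]
    rw [Real.div_rpow e0.le (by positivity), Real.div_rpow (by positivity) (by positivity)]
    rw [← Real.rpow_natCast_mul h0.le, ← Real.rpow_natCast_mul hy.le,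
      ← Real.rpow_natCast_mul hy.le]
    rw [show (4 * α + s - 2) = ((2 : ℕ) : ℝ) * (2 * α - 1) + (2 : ℕ) * (s / 2 - 1) + (2 : ℕ) by
      push_cast; ring, show s - 1 = (2 : ℕ) * (s / 2 - 1) + 1 by push_cast; ring,
      Real.rpow_add hy, Real.rpow_add hy, Real.rpow_natCast, Real.rpow_add h0, Real.rpow_one]
    have := Real.rpow_pos_of_pos hy ((2 : ℕ) * (2 * α - 1))
    have := Real.rpow_pos_of_pos hy ((2 : ℕ) * (s / 2 - 1))
    field_simp
  · intro x _
    have := (((hasDerivAt_id x).pow 2).div_const (y ^ 2)).const_sub 1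
    have e : -(2 * x / y ^ 2) = -(((2 : ℕ) : ℝ) * id x ^ (2 - 1) * 1 / y ^ 2) := by simp
    rw [← e] at this
    exact this.hasDerivWithinAt
  · rintro x ⟨hx, _⟩ z ⟨hz, _⟩ h
    have h : 1 - x ^ 2 / y ^ 2 = 1 - z ^ 2 / y ^ 2 := h
    rw [sub_right_inj] at h
    have h' : x ^ 2 = z ^ 2 := by
      field_simp at h
      exact h
    exact (pow_left_inj₀ hx.le hz.le two_ne_zero).1 h'
end

section
/- Let ν ≥ 0, α > 0, β > 0, and let f : (0,∞) → ℝ be smooth with compact support contained in (0,∞). Then the fractional Bessel integrals satisfy the semigroup property (index law): for every x > 0, (IB_{ν,-}^α (IB_{ν,-}^β f))(x) = (IB_{ν,-}^{α+β} f)(x). -/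
open MeasureTheory Set

/-- Fractional Bessel integral on the semiaxis. -/
noncomputable def IB (ν α : ℝ) (f : ℝ → ℝ) (x : ℝ) : ℝ :=
  (1 / Real.Gamma (2 * α)) *
    ∫ y in Ioi x, ((y ^ 2 - x ^ 2) / (2 * y)) ^ (2 * α - 1) *
      gaussHyp (α + (ν - 1) / 2) α (2 * α) (1 - x ^ 2 / y ^ 2) * f y


lemma poch_choose (a : ℝ) (n : ℕ) : Ring.choose (a + n - 1) n = (ascPochhammer ℝ n).eval a / n.factorial := by
  have h := Ring.factorial_nsmul_multichoose_eq_ascPochhammer a n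
  rw [Polynomial.ascPochhammer_smeval_eq_eval] at h
  rw [← h, ← Ring.multichoose_eq]
  rw [nsmul_eq_mul]; field_simp

lemma binom_hasSum (a u : ℝ) (h0 : 0 ≤ u) (h1 : u < 1) :
    HasSum (fun n : ℕ => (ascPochhammer ℝ n).eval a / n.factorial * u ^ n) ((1 - u) ^ (-a)) := by
  have h := (Real.one_div_one_sub_rpow_hasFPowerSeriesOnBall_zero a).hasSum (y := u) (by
    simp [abs_of_nonneg h0, enorm, ← NNReal.coe_lt_coe,  h1])
  simp only [FormalMultilinearSeries.ofScalars_apply_eq, poch_choose, zero_add, smul_eq_mul] at h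
  rwa [Real.rpow_neg (by linarith), ← one_div]

lemma Gamma_add_nat (z : ℝ) (hz : 0 < z) (n : ℕ) :
    Real.Gamma (z + n) = Real.Gamma z * (ascPochhammer ℝ n).eval z := by
  induction n with
  | zero => simp
  | succ n ih =>
    rw [ascPochhammer_succ_eval, Nat.cast_succ, ← add_assoc, Real.Gamma_add_one (by positivity), ih]
    ring

lemma abs_poch_le (a : ℝ) (n : ℕ) : |(ascPochhammer ℝ n).eval a| ≤ (ascPochhammer ℝ n).eval |a| := by
  induction n with
  | zero => simp
  | succ n ih =>
    rw [ascPochhammer_succ_eval, ascPochhammer_succ_eval, abs_mul]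
    have : |a + n| ≤ |a| + n := by
      calc _ ≤ |a| + |(n:ℝ)| := abs_add_le _ _
        _ = _ := by simp
    exact mul_le_mul ih this (abs_nonneg _) (le_trans (abs_nonneg _) ih)

/-- beta function -/
noncomputable def Bt (p q : ℝ) : ℝ := Real.Gamma p * Real.Gamma q / Real.Gamma (p + q)

lemma beta_int (p q : ℝ) (hp : 0 < p) (hq : 0 < q) :
    IntegrableOn (fun t : ℝ => t ^ (p - 1) * (1 - t) ^ (q - 1)) (Ioo 0 1) ∧
    ∫ t in Ioo (0:ℝ) 1, t ^ (p - 1) * (1 - t) ^ (q - 1) = Bt p q := by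
  have hc := Complex.betaIntegral_convergent (u := p) (v := q) (by simpa) (by simpa)
  rw [intervalIntegrable_iff_integrableOn_Ioo_of_le zero_le_one] at hc
  have key : EqOn (fun x : ℝ => (x:ℂ) ^ ((p:ℂ) - 1) * (1 - (x:ℂ)) ^ ((q:ℂ) - 1))
      (fun t : ℝ => ((t ^ (p - 1) * (1 - t) ^ (q - 1) : ℝ) : ℂ)) (Ioo 0 1) := by
    intro t ht
    simp only
    rw [Complex.ofReal_mul, Complex.ofReal_cpow ht.1.le, Complex.ofReal_cpow (by linarith [ht.2])]
    simp
  have hi : IntegrableOn (fun t : ℝ => t ^ (p - 1) * (1 - t) ^ (q - 1)) (Ioo 0 1) := by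
    have := (hc.congr_fun key measurableSet_Ioo).re
    simpa using! this
  refine ⟨hi, ?_⟩
  have h2 := Complex.betaIntegral_eq_Gamma_mul_div (p:ℂ) q (by simpa) (by simpa)
  rw [Complex.betaIntegral, intervalIntegral.integral_of_le zero_le_one,  
   integral_Ioc_eq_integral_Ioo, setIntegral_congr_fun measurableSet_Ioo key, integral_complex_ofReal] at h2
  rw [← Complex.ofReal_add, Complex.Gamma_ofReal, Complex.Gamma_ofReal, Complex.Gamma_ofReal] at h2
  exact_mod_cast h2

lemma integrable_tsum_aux {F : ℕ → ℝ → ℝ} {μ : Measure ℝ}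
    (hF : ∀ i, Integrable (F i) μ) (hs : Summable fun i ↦ ∫ a, ‖F i a‖ ∂μ) :
    Integrable (fun a => ∑' i, F i a) μ := by
  refine ⟨(AEMeasurable.tsum fun i => (hF i).1.aemeasurable).aestronglyMeasurable, ?_⟩
  have h1 : ∫⁻ a, ‖∑' i, F i a‖ₑ ∂μ ≤ ∑' i, ∫⁻ a, ‖F i a‖ₑ ∂μ := by
    rw [← lintegral_tsum fun i => (hF i).1.enorm]
    exact lintegral_mono fun a => enorm_tsum_le_tsum_enorm
  refine lt_of_le_of_lt h1 ?_
  have : ∀ i, ∫⁻ a, ‖F i a‖ₑ ∂μ = ENNReal.ofReal (∫ a, ‖F i a‖ ∂μ) := fun i =>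
    (ofReal_integral_norm_eq_lintegral_enorm (hF i)).symm
  simp_rw [this]
  rw [← ENNReal.ofReal_tsum_of_nonneg (fun i => integral_nonneg fun a => norm_nonneg _) hs]
  exact ENNReal.ofReal_lt_top

lemma poch_nonneg (a : ℝ) (ha : 0 ≤ a) (n : ℕ) : 0 ≤ (ascPochhammer ℝ n).eval a := by
  have := abs_poch_le a n
  rw [abs_of_nonneg ha] at this
  exact le_trans (abs_nonneg _) this

lemma shift_fun (p q : ℝ) (n : ℕ) (t : ℝ) (ht : t ∈ Ioo (0:ℝ) 1) :
    t ^ (p + n - 1) * (1 - t) ^ (q - 1) = t ^ n * (t ^ (p - 1) * (1 - t) ^ (q - 1)) := by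
  rw [show p + n - 1 = (p - 1) + n by ring, Real.rpow_add ht.1, Real.rpow_natCast]; ring

lemma beta_summable (a b τ : ℝ) (ha : 0 ≤ a) (hb : 0 < b) (hτ : a < τ) :
    Summable (fun n : ℕ => (ascPochhammer ℝ n).eval a / n.factorial * Bt (b + n) τ) := by
  have hpos : ∀ n : ℕ, 0 ≤ (ascPochhammer ℝ n).eval a / n.factorial := fun n =>
    div_nonneg (poch_nonneg a ha n) (by positivity)
  refine summable_of_sum_range_le (c := Bt b (τ - a)) ?_ ?_
  · intro n
    refine mul_nonneg (hpos n) ?_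
    have h1 : 0 < b + n := by positivity
    have h2 : 0 < τ := by linarith
    have := Real.Gamma_pos_of_pos h1
    have := Real.Gamma_pos_of_pos h2
    have := Real.Gamma_pos_of_pos (add_pos h1 h2)
    unfold Bt; positivity
  · intro N
    have hi : ∀ n : ℕ, IntegrableOn (fun t : ℝ => (ascPochhammer ℝ n).eval a / n.factorial *
        (t ^ (b + n - 1) * (1 - t) ^ (τ - 1))) (Ioo 0 1) := fun n =>
      (beta_int (b + n) τ (by positivity) (by linarith)).1.const_mul _
    have : ∀ n : ℕ, (ascPochhammer ℝ n).eval a / n.factorial * Bt (b + n) τ =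
        ∫ t in Ioo (0:ℝ) 1, (ascPochhammer ℝ n).eval a / n.factorial *
        (t ^ (b + n - 1) * (1 - t) ^ (τ - 1)) := fun n => by
      rw [integral_const_mul, (beta_int (b + n) τ (by positivity) (by linarith)).2]
    simp_rw [this]
    rw [← integral_finsetSum _ fun i _ => hi i, ← (beta_int b (τ - a) hb (by linarith)).2]
    refine setIntegral_mono_on (integrable_finsetSum _ fun i _ => hi i)
      (beta_int b (τ - a) hb (by linarith)).1 measurableSet_Ioo ?_
    intro t ht
    have h1 : 0 < 1 - t := by linarith [ht.2]
    have hsum := binom_hasSum a t ht.1.le ht.2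
    have hle := hsum.summable.sum_le_tsum (Finset.range N) (fun n _ => mul_nonneg (hpos n)
      (pow_nonneg ht.1.le n))
    rw [hsum.tsum_eq] at hle
    have e : t ^ (b - 1) * (1 - t) ^ (τ - a - 1) = (1 - t) ^ (-a) * (t ^ (b - 1) * (1 - t) ^ (τ - 1)) := by
      rw [show τ - a - 1 = -a + (τ - 1) by ring, Real.rpow_add h1]; ring
    rw [e]
    simp_rw [shift_fun b τ _ t ht, ← mul_assoc]
    rw [← Finset.sum_mul, ← Finset.sum_mul]
    have := Real.rpow_nonneg ht.1.le (b-1)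
    have := Real.rpow_nonneg h1.le (τ-1)
    gcongr

lemma Bt_nonneg (p q : ℝ) (hp : 0 < p) (hq : 0 < q) : 0 ≤ Bt p q := by
  have := Real.Gamma_pos_of_pos hp
  have := Real.Gamma_pos_of_pos hq
  have := Real.Gamma_pos_of_pos (add_pos hp hq)
  unfold Bt; positivity

lemma norm_int (A p q : ℝ) (hp : 0 < p) (hq : 0 < q) :
    ∫ t in Ioo (0:ℝ) 1, ‖A * (t ^ (p - 1) * (1 - t) ^ (q - 1))‖ = |A| * Bt p q := by
  rw [← (beta_int p q hp hq).2, ← integral_const_mul]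
  refine setIntegral_congr_fun measurableSet_Ioo fun t ht => ?_
  have := Real.rpow_nonneg ht.1.le (p-1)
  have := Real.rpow_nonneg (sub_nonneg.2 ht.2.le) (q-1)
  simp only [norm_mul, Real.norm_eq_abs]
  rw [abs_of_nonneg (Real.rpow_nonneg ht.1.le (p-1)), abs_of_nonneg (Real.rpow_nonneg (sub_nonneg.2 ht.2.le) (q-1))]

lemma beta_summable_abs (a b τ : ℝ) (hb : 0 < b) (hτ : |a| < τ) :
    Summable (fun n : ℕ => |(ascPochhammer ℝ n).eval a / n.factorial| * Bt (b + n) τ) := by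
  have h0 : 0 < τ := lt_of_le_of_lt (abs_nonneg _) hτ
  refine Summable.of_nonneg_of_le (fun n => mul_nonneg (abs_nonneg _) (Bt_nonneg _ _ (by positivity) h0))
    (fun n => ?_) (beta_summable |a| b τ (abs_nonneg _) hb hτ)
  have := Bt_nonneg (b+n) τ (by positivity) h0
  rw [abs_div, Nat.abs_cast]
  have := abs_poch_le a n
  gcongr

lemma beta_hasSum (a b τ : ℝ) (hb : 0 < b) (hτ : |a| < τ) :
    HasSum (fun n : ℕ => (ascPochhammer ℝ n).eval a / n.factorial * Bt (b + n) τ) (Bt b (τ - a)) := by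
  have h0 : 0 < τ := lt_of_le_of_lt (abs_nonneg _) hτ
  have h := hasSum_integral_of_summable_integral_norm (μ := volume.restrict (Ioo (0:ℝ) 1))
    (F := fun (n : ℕ) (t : ℝ) => (ascPochhammer ℝ n).eval a / n.factorial *
        (t ^ (b + n - 1) * (1 - t) ^ (τ - 1)))
    (fun n => (beta_int (b + n) τ (by positivity) h0).1.const_mul _) (by
      convert! beta_summable_abs a b τ hb hτ using 2 with n
      exact norm_int _ _ _ (by positivity) h0)
  convert! h using 1
  · ext n
    rw [integral_const_mul, (beta_int (b + n) τ (by positivity) h0).2]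
  · rw [← (beta_int b (τ - a) hb (by linarith [le_abs_self a])).2]
    refine setIntegral_congr_fun measurableSet_Ioo fun t ht => ?_
    have h1 : 0 < 1 - t := by linarith [ht.2]
    simp_rw [shift_fun b τ _ t ht, ← mul_assoc]
    rw [tsum_mul_right, tsum_mul_right, (binom_hasSum a t ht.1.le ht.2).tsum_eq,
      show τ - a - 1 = -a + (τ - 1) by ring, Real.rpow_add h1]; ring

lemma coef_eq (a b c σ : ℝ) (hb : 0 < b) (hc : 0 < c) (hσ : 0 < c + σ - b) (hσ' : 0 < σ) (n : ℕ) :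
    ((ascPochhammer ℝ n).eval a * (ascPochhammer ℝ n).eval b /
    ((ascPochhammer ℝ n).eval c * (n.factorial : ℝ))) * Bt (c + n) σ =
    (Real.Gamma c * Real.Gamma σ / (Real.Gamma b * Real.Gamma (c + σ - b))) *
      ((ascPochhammer ℝ n).eval a / n.factorial * Bt (b + n) (c + σ - b)) := by
  unfold Bt
  rw [show b + n + (c + σ - b) = c + n + σ by ring, Gamma_add_nat b hb, Gamma_add_nat c hc]
  have := Real.Gamma_pos_of_pos hb
  have := Real.Gamma_pos_of_pos hσ
  have : 0 < Real.Gamma (c + n + σ) := Real.Gamma_pos_of_pos (by positivity)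
  have := ascPochhammer_pos n c hc
  field_simp

lemma hyp_moment (a b c σ : ℝ) (hb : 0 < b) (hc : 0 < c) (hσ : |a| < c + σ - b) (hσ' : 0 < σ) :
    IntegrableOn (fun t : ℝ => t ^ (c - 1) * (1 - t) ^ (σ - 1) * gaussHyp a b c t) (Ioo 0 1) ∧
    ∫ t in Ioo (0:ℝ) 1, t ^ (c - 1) * (1 - t) ^ (σ - 1) * gaussHyp a b c t =
      (Real.Gamma c * Real.Gamma σ / (Real.Gamma b * Real.Gamma (c + σ - b))) *
        Bt b (c + σ - b - a) := by
  set A : ℕ → ℝ := fun n => ((ascPochhammer ℝ n).eval a * (ascPochhammer ℝ n).eval b /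
    ((ascPochhammer ℝ n).eval c * (n.factorial : ℝ))) with hA
  have h0 : 0 < c + σ - b := lt_of_le_of_lt (abs_nonneg _) hσ
  have hI : ∀ n : ℕ, IntegrableOn (fun t : ℝ => A n * (t ^ (c + n - 1) * (1 - t) ^ (σ - 1))) (Ioo 0 1) :=
    fun n => (beta_int (c + n) σ (by positivity) hσ').1.const_mul _
  have hS : Summable fun n : ℕ => ∫ t in Ioo (0:ℝ) 1, ‖A n * (t ^ (c + n - 1) * (1 - t) ^ (σ - 1))‖ := by
    convert! (beta_summable_abs a b _ hb hσ).mul_left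
      |Real.Gamma c * Real.Gamma σ / (Real.Gamma b * Real.Gamma (c + σ - b))| using 2 with n
    rw [norm_int _ _ _ (by positivity) hσ']
    have h := congrArg abs (coef_eq a b c σ hb hc h0 hσ' n)
    rwa [abs_mul, abs_mul, abs_mul _ (Bt _ _), abs_of_nonneg (Bt_nonneg _ _ (by positivity) hσ'),
      abs_of_nonneg (Bt_nonneg _ _ (by positivity) h0)] at h
  have hfun : EqOn (fun t => ∑' n : ℕ, A n * (t ^ (c + n - 1) * (1 - t) ^ (σ - 1)))
      (fun t : ℝ => t ^ (c - 1) * (1 - t) ^ (σ - 1) * gaussHyp a b c t) (Ioo 0 1) := by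
    intro t ht
    simp only
    simp_rw [shift_fun c σ _ t ht, ← mul_assoc (A _)]
    rw [tsum_mul_right, mul_comm]; rfl
  constructor
  · exact IntegrableOn.congr_fun (integrable_tsum_aux hI hS) hfun measurableSet_Ioo
  · rw [← setIntegral_congr_fun measurableSet_Ioo hfun]
    have h1 := hasSum_integral_of_summable_integral_norm hI hS
    refine h1.unique ?_
    convert! (beta_hasSum a b _ hb hσ).mul_left
      (Real.Gamma c * Real.Gamma σ / (Real.Gamma b * Real.Gamma (c + σ - b))) using 2 with n
    rw [integral_const_mul, (beta_int (c + n) σ (by positivity) hσ').2]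
    exact coef_eq a b c σ hb hc h0 hσ' n

lemma cov (x : ℝ) (hx : 0 < x) (α s : ℝ) (G : ℝ → ℝ) :
    (IntegrableOn (fun t : ℝ => t ^ (2 * α - 1) * (1 - t) ^ (s / 2 - α - 1) * G t) (Ioo 0 1) →
      IntegrableOn (fun y : ℝ => ((y ^ 2 - x ^ 2) / (2 * y)) ^ (2 * α - 1) *
        G (1 - x ^ 2 / y ^ 2) * y ^ (-s)) (Ioi x)) ∧
    ∫ y in Ioi x, ((y ^ 2 - x ^ 2) / (2 * y)) ^ (2 * α - 1) * G (1 - x ^ 2 / y ^ 2) * y ^ (-s) =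
      (2:ℝ) ^ (-(2 * α)) * x ^ (2 * α - s) *
        ∫ t in Ioo (0:ℝ) 1, t ^ (2 * α - 1) * (1 - t) ^ (s / 2 - α - 1) * G t := by
  have hder : ∀ y ∈ Ioi x, HasDerivWithinAt (fun y : ℝ => 1 - x ^ 2 / y ^ 2) (2 * x ^ 2 / y ^ 3) (Ioi x) y := by
    intro y hy
    have hy0 : y ≠ 0 := (hx.trans hy).ne'
    have h := (((hasDerivAt_id y).pow 2).inv (pow_ne_zero 2 hy0)).const_mul (x ^ 2)
    have h2 := (h.const_sub 1).hasDerivWithinAt (s := Ioi x)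
    simp only [id] at h2
    refine (h2.congr_deriv ?_)
    simp
    field_simp
  have hinj : InjOn (fun y : ℝ => 1 - x ^ 2 / y ^ 2) (Ioi x) := by
    intro y hy z hz h
    have hy0 : 0 < y := hx.trans hy
    have hz0 : 0 < z := hx.trans hz
    simp only at h
    have h3 : x ^ 2 / y ^ 2 = x ^ 2 / z ^ 2 := by linarith
    field_simp at h3
    exact ((sq_eq_sq₀ hz0.le hy0.le).1 h3).symm
  have himg : (fun y : ℝ => 1 - x ^ 2 / y ^ 2) '' Ioi x = Ioo 0 1 := by
    ext t
    constructor
    · rintro ⟨y, hy, rfl⟩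
      have hy0 : 0 < y := hx.trans hy
      have hy1 : x < y := hy
      have : x ^ 2 / y ^ 2 < 1 := by
        rw [div_lt_one (by positivity)]; gcongr
      have : 0 < x ^ 2 / y ^ 2 := by positivity
      constructor <;> simp only <;> linarith
    · rintro ⟨h0, h1⟩
      have h1' : 0 < 1 - t := by linarith
      have hs : 0 < Real.sqrt (1 - t) := Real.sqrt_pos.2 h1'
      refine ⟨x / Real.sqrt (1 - t), ?_, ?_⟩
      · rw [mem_Ioi, lt_div_iff₀ hs]
        have : Real.sqrt (1 - t) < 1 := by
          rw [Real.sqrt_lt' one_pos]; linarith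
        nlinarith
      · simp only
        rw [div_pow, Real.sq_sqrt h1'.le]
        field_simp
        ring
  have key : EqOn (fun y => (2:ℝ) ^ (-(2 * α)) * x ^ (2 * α - s) * (|2 * x ^ 2 / y ^ 3| •
      ((1 - x ^ 2 / y ^ 2) ^ (2 * α - 1) * (1 - (1 - x ^ 2 / y ^ 2)) ^ (s / 2 - α - 1) *
        G (1 - x ^ 2 / y ^ 2))))
      (fun y => ((y ^ 2 - x ^ 2) / (2 * y)) ^ (2 * α - 1) * G (1 - x ^ 2 / y ^ 2) * y ^ (-s)) (Ioi x) := by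
    intro y hy
    have hy0 : 0 < y := hx.trans hy
    have hy1 : x < y := hy
    have ht : 0 < 1 - x ^ 2 / y ^ 2 := by
      have : x ^ 2 / y ^ 2 < 1 := by
        rw [div_lt_one (by positivity)]; gcongr
      linarith
    simp only [smul_eq_mul]
    rw [show (y ^ 2 - x ^ 2) / (2 * y) = (1 - x ^ 2 / y ^ 2) * (y / 2) by field_simp,
      Real.mul_rpow ht.le (by positivity), Real.div_rpow hy0.le (by norm_num),
      abs_of_pos (by positivity), show 1 - (1 - x ^ 2 / y ^ 2) = x ^ 2 / y ^ 2 by ring,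
      Real.div_rpow (by positivity) (by positivity)]
    have e1 : ∀ z : ℝ, 0 < z → (z ^ 2) ^ (s / 2 - α - 1) = z ^ (s - 2 * α) / z ^ 2 := by
      intro z hz
      rw [← Real.rpow_natCast z 2, ← Real.rpow_mul hz.le, ← Real.rpow_sub hz]
      congr 1; push_cast; ring
    rw [e1 x hx, e1 y hy0]
    rw [Real.rpow_sub_one hy0.ne', Real.rpow_sub_one (two_ne_zero), Real.rpow_neg (by norm_num),
      Real.rpow_neg hy0.le, Real.rpow_sub hx, Real.rpow_sub hx, Real.rpow_sub hy0]
    have := Real.rpow_pos_of_pos hx (2 * α)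
    have := Real.rpow_pos_of_pos hx s
    have := Real.rpow_pos_of_pos hy0 (2 * α)
    have := Real.rpow_pos_of_pos hy0 s
    have := Real.rpow_pos_of_pos (two_pos (α := ℝ)) (2 * α)
    field_simp
  constructor
  · intro h
    rw [← himg, integrableOn_image_iff_integrableOn_abs_deriv_smul measurableSet_Ioi hder hinj] at h
    exact IntegrableOn.congr_fun (h.const_mul _) key measurableSet_Ioi
  · rw [← himg, integral_image_eq_integral_abs_deriv_smul measurableSet_Ioi hder hinj,
      ← integral_const_mul]
    exact (setIntegral_congr_fun measurableSet_Ioi key).symm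

noncomputable def kk (ν α x y : ℝ) : ℝ := (1 / Real.Gamma (2 * α)) *
  (((y ^ 2 - x ^ 2) / (2 * y)) ^ (2 * α - 1) *
      gaussHyp (α + (ν - 1) / 2) α (2 * α) (1 - x ^ 2 / y ^ 2))

lemma IB_eq (ν α : ℝ) (f : ℝ → ℝ) (x : ℝ) : IB ν α f x = ∫ y in Ioi x, kk ν α x y * f y := by
  rw [IB, ← integral_const_mul]
  simp only [kk, mul_assoc]

noncomputable def mm (ν α s : ℝ) : ℝ := (2:ℝ) ^ (-(2 * α)) *
  (Real.Gamma (s / 2 - α) * Real.Gamma (s / 2 - α - (ν - 1) / 2) /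
    (Real.Gamma (s / 2) * Real.Gamma (s / 2 - (ν - 1) / 2)))

lemma kk_power (ν α s : ℝ) (hα : 0 < α) (hs : |α + (ν - 1) / 2| + α < s / 2) (x : ℝ) (hx : 0 < x) :
    IntegrableOn (fun y => kk ν α x y * y ^ (-s)) (Ioi x) ∧
    ∫ y in Ioi x, kk ν α x y * y ^ (-s) = mm ν α s * x ^ (2 * α - s) := by
  have ha := abs_nonneg (α + (ν - 1) / 2)
  have h := hyp_moment (α + (ν - 1) / 2) α (2 * α) (s / 2 - α) hα (by positivity) (by linarith)
    (by linarith)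
  have hc := cov x hx α s (gaussHyp (α + (ν - 1) / 2) α (2 * α))
  constructor
  · have := (hc.1 h.1).const_mul (1 / Real.Gamma (2 * α))
    simpa only [kk, mul_assoc] using! this
  · have e : ∀ y, kk ν α x y * y ^ (-s) = (1 / Real.Gamma (2 * α)) * (((y ^ 2 - x ^ 2) / (2 * y)) ^ (2 * α - 1) *
      gaussHyp (α + (ν - 1) / 2) α (2 * α) (1 - x ^ 2 / y ^ 2) * y ^ (-s)) := by
      intro y; simp only [kk, mul_assoc]
    simp_rw [e]
    rw [integral_const_mul, hc.2, h.2, mm, Bt]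
    have := Real.Gamma_pos_of_pos hα
    have : 0 < Real.Gamma (2 * α) := Real.Gamma_pos_of_pos (by positivity)
    rw [show 2 * α + (s / 2 - α) - α = s / 2 by ring,
      show α + (s / 2 - (α + (ν - 1) / 2)) = s / 2 - (ν - 1) / 2 by ring,
      show s / 2 - (α + (ν - 1) / 2) = s / 2 - α - (ν - 1) / 2 by ring]
    field_simp

lemma kk_abs (ν α s : ℝ) (hα : 0 < α) :
    ∃ M : ℝ, 0 ≤ M ∧ ∀ x : ℝ, 0 < x → 
    ∫ y in Ioi x, |kk ν α x y| * y ^ (-s) = M * x ^ (2 * α - s) := by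
  have : 0 < Real.Gamma (2 * α) := Real.Gamma_pos_of_pos (by positivity)
  refine ⟨1 / Real.Gamma (2 * α) * ((2:ℝ) ^ (-(2 * α)) * ∫ t in Ioo (0:ℝ) 1, t ^ (2 * α - 1) * (1 - t) ^ (s / 2 - α - 1) * 
    |gaussHyp (α + (ν - 1) / 2) α (2 * α) t|), ?_, ?_⟩
  · have : 0 ≤ ∫ t in Ioo (0:ℝ) 1, t ^ (2 * α - 1) * (1 - t) ^ (s / 2 - α - 1) * 
        |gaussHyp (α + (ν - 1) / 2) α (2 * α) t| := by
      refine setIntegral_nonneg measurableSet_Ioo fun t ht => ?_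
      have := Real.rpow_nonneg ht.1.le (2 * α - 1)
      have := Real.rpow_nonneg (sub_nonneg.2 ht.2.le) (s / 2 - α - 1)
      positivity
    positivity
  · intro x hx
    have hc := (cov x hx α s (fun t => |gaussHyp (α + (ν - 1) / 2) α (2 * α) t|)).2
    have e : EqOn (fun y => |kk ν α x y| * y ^ (-s)) (fun y => (1 / Real.Gamma (2 * α)) * (((y ^ 2 - x ^ 2) / (2 * y)) ^ (2 * α - 1) *
      |gaussHyp (α + (ν - 1) / 2) α (2 * α) (1 - x ^ 2 / y ^ 2)| * y ^ (-s))) (Ioi x) := by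
      intro y hy
      have hy0 : 0 < y := hx.trans hy
      have hy1 : x < y := hy
      have : 0 ≤ (y ^ 2 - x ^ 2) / (2 * y) := by
        have : x ^ 2 ≤ y ^ 2 := by gcongr
        exact div_nonneg (by linarith) (by positivity)
      simp only [kk]
      rw [abs_mul, abs_mul, abs_of_pos (by positivity : 0 < 1 / Real.Gamma (2 * α)),
        abs_of_nonneg (Real.rpow_nonneg this _)]
      ring
    rw [setIntegral_congr_fun measurableSet_Ioi e, integral_const_mul, hc]
    ring

lemma mm_mul (ν α β s : ℝ) (h1 : 0 < s / 2 - β) (h2 : 0 < s / 2 - β - (ν - 1) / 2) :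
    mm ν α (s - 2 * β) * mm ν β s = mm ν (α + β) s := by
  unfold mm
  rw [show (s - 2 * β) / 2 = s / 2 - β by ring, show s / 2 - (α + β) = s / 2 - β - α by ring,
    show (-(2 * (α + β))) = -(2 * α) + -(2 * β) by ring, Real.rpow_add two_pos]
  have := Real.Gamma_pos_of_pos h1
  have := Real.Gamma_pos_of_pos h2
  generalize Real.Gamma (s / 2 - β) = A at *
  generalize Real.Gamma (s / 2 - β - (ν - 1) / 2) = B at *
  generalize Real.Gamma (s / 2 - (ν - 1) / 2) = C at *
  generalize Real.Gamma (s / 2) = D at *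
  generalize Real.Gamma (s / 2 - β - α) = E at *
  generalize Real.Gamma (s / 2 - β - α - (ν - 1) / 2) = F at *
  field_simp

lemma op_bound (ν α s : ℝ) (hα : 0 < α) (hs : |α + (ν - 1) / 2| + α < s / 2) (M : ℝ)
    (hM : ∀ x : ℝ, 0 < x → ∫ y in Ioi x, |kk ν α x y| * y ^ (-s) = M * x ^ (2 * α - s))
    (x : ℝ) (hx : 0 < x) (f : ℝ → ℝ) (hm : AEStronglyMeasurable f (volume.restrict (Ioi x)))
    (ε : ℝ) (hb : ∀ z ∈ Ioi x, |f z| ≤ ε * z ^ (-s)) :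
    IntegrableOn (fun y => kk ν α x y * f y) (Ioi x) ∧
    |∫ y in Ioi x, kk ν α x y * f y| ≤ ε * (M * x ^ (2 * α - s)) := by
  have hk := (kk_power ν α s hα hs x hx).1
  have habs : EqOn (fun y => ‖kk ν α x y * y ^ (-s)‖) (fun y => |kk ν α x y| * y ^ (-s)) (Ioi x) := by
    intro y hy
    have hy0 : 0 < y := hx.trans hy
    simp only [Real.norm_eq_abs, abs_mul]
    rw [abs_of_pos (Real.rpow_pos_of_pos hy0 _)]
  have hk' : IntegrableOn (fun y => |kk ν α x y| * y ^ (-s)) (Ioi x) :=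
    IntegrableOn.congr_fun hk.norm habs measurableSet_Ioi
  constructor
  · have hm2 : AEStronglyMeasurable (fun z => f z * z ^ s) (volume.restrict (Ioi x)) :=
      hm.mul (by fun_prop : Measurable fun z : ℝ => z ^ s).aestronglyMeasurable
    have := Integrable.mul_bdd (c := ε) hk hm2 (by
      refine ae_restrict_of_forall_mem measurableSet_Ioi fun z hz => ?_
      have hz0 : 0 < z := hx.trans hz
      have := Real.rpow_pos_of_pos hz0 s
      rw [Real.norm_eq_abs, abs_mul, abs_of_pos this]
      calc _ ≤ ε * z ^ (-s) * z ^ s := by gcongr; exact hb z hz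
        _ = ε := by rw [Real.rpow_neg hz0.le]; field_simp)
    refine IntegrableOn.congr_fun this (fun z hz => ?_) measurableSet_Ioi
    have hz0 : 0 < z := hx.trans hz
    have := Real.rpow_pos_of_pos hz0 s
    rw [Real.rpow_neg hz0.le]; field_simp
  · rw [← hM x hx, ← integral_const_mul, ← Real.norm_eq_abs]
    refine norm_integral_le_of_norm_le (hk'.const_mul ε) ?_
    refine ae_restrict_of_forall_mem measurableSet_Ioi fun z hz => ?_
    rw [Real.norm_eq_abs, abs_mul]
    calc _ ≤ |kk ν α x z| * (ε * z ^ (-s)) := by gcongr; exact hb z hz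
      _ = _ := by ring

lemma IB_close (ν α s : ℝ) (hα : 0 < α) (hs : |α + (ν - 1) / 2| + α < s / 2) (M : ℝ)
    (hM : ∀ x : ℝ, 0 < x → ∫ y in Ioi x, |kk ν α x y| * y ^ (-s) = M * x ^ (2 * α - s))
    (x : ℝ) (hx : 0 < x) (f : ℝ → ℝ) (hm : AEStronglyMeasurable f (volume.restrict (Ioi x)))
    (ε : ℝ) (N : ℕ) (c r : ℕ → ℝ) (hr : ∀ i, |α + (ν - 1) / 2| + α < r i / 2)
    (hb : ∀ z ∈ Ioi x, |f z - ∑ i ∈ Finset.range N, c i * z ^ (-(r i))| ≤ ε * z ^ (-s)) :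
    |IB ν α f x - ∑ i ∈ Finset.range N, c i * (mm ν α (r i) * x ^ (2 * α - r i))| ≤
      ε * (M * x ^ (2 * α - s)) := by
  have hi : ∀ i ∈ Finset.range N, Integrable (fun y => c i * (kk ν α x y * y ^ (-(r i))))
      (volume.restrict (Ioi x)) := fun i _ =>
    (kk_power ν α (r i) hα (hr i) x hx).1.const_mul (c i)
  have hsumint := integrable_finsetSum _ hi
  have hsum : ∫ y in Ioi x, ∑ i ∈ Finset.range N, c i * (kk ν α x y * y ^ (-(r i))) =
      ∑ i ∈ Finset.range N, c i * (mm ν α (r i) * x ^ (2 * α - r i)) := by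
    rw [integral_finsetSum _ hi]
    refine Finset.sum_congr rfl fun i _ => ?_
    rw [integral_const_mul, (kk_power ν α (r i) hα (hr i) x hx).2]
  have hm2 : AEStronglyMeasurable (fun z => f z - ∑ i ∈ Finset.range N, c i * z ^ (-(r i)))
      (volume.restrict (Ioi x)) :=
    hm.sub (by fun_prop : Measurable fun z : ℝ =>
      ∑ i ∈ Finset.range N, c i * z ^ (-(r i))).aestronglyMeasurable
  have hop := op_bound ν α s hα hs M hM x hx _ hm2 ε hb
  have e : IB ν α f x - ∑ i ∈ Finset.range N, c i * (mm ν α (r i) * x ^ (2 * α - r i)) =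
      ∫ y in Ioi x, kk ν α x y * (f y - ∑ i ∈ Finset.range N, c i * y ^ (-(r i))) := by
    rw [← hsum, IB_eq, sub_eq_iff_eq_add, ← integral_add hop.1 hsumint]
    congr 1
    ext y
    rw [mul_sub, Finset.mul_sum]
    have : ∀ i, kk ν α x y * (c i * y ^ (-(r i))) = c i * (kk ν α x y * y ^ (-(r i))) := fun i => by ring
    simp_rw [this]
    ring
  rw [e]
  exact hop.2

lemma approx (f : ℝ → ℝ) (hf : Continuous f) (hsupp : HasCompactSupport f)
    (hsupp' : tsupport f ⊆ Ioi (0 : ℝ)) (x : ℝ) (hx : 0 < x) (s : ℝ) (ε : ℝ) (hε : 0 < ε) :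
    ∃ (N : ℕ) (c : ℕ → ℝ), ∀ z ∈ Ioi x,
      |f z - ∑ i ∈ Finset.range N, c i * z ^ (-(s + i))| ≤ ε * z ^ (-s) := by
  have hf0 : f 0 = 0 := by
    by_contra h
    have : (0:ℝ) ∈ tsupport f := subset_tsupport f h
    exact lt_irrefl (0:ℝ) (mem_Ioi.1 (hsupp' this))
  obtain ⟨R, hR⟩ := hsupp.isBounded.subset_closedBall (0:ℝ)
  have hR' : ∀ z, R < |z| → f z = 0 := by
    intro z hz
    by_contra h
    have : z ∈ tsupport f := subset_tsupport f h
    have := hR this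
    simp at this
    linarith
  have hc : ContinuousOn (fun w : ℝ => f w⁻¹ * (w⁻¹) ^ s) (Icc 0 x⁻¹) := by
    intro w hw
    apply ContinuousAt.continuousWithinAt
    rcases eq_or_lt_of_le hw.1 with h | h
    · subst h
      have : (fun w : ℝ => f w⁻¹ * (w⁻¹) ^ s) =ᶠ[nhds 0] fun _ => 0 := by
        have : ∀ᶠ w : ℝ in nhds 0, |w| < (|R| + 1)⁻¹ := by
          refine (continuous_abs.tendsto 0).eventually_lt_const ?_
          simp; positivity
        filter_upwards [this] with w hw
        rcases eq_or_ne w 0 with h0 | h0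
        · subst h0; simp [hf0]
        · rw [hR' w⁻¹, zero_mul]
          have : 0 < |w| := abs_pos.2 h0
          rw [abs_inv]
          rw [lt_inv_comm₀ this (by positivity)] at hw
          linarith [le_abs_self R]
      exact continuousAt_const.congr this.symm
    · have hi : ContinuousAt (fun w : ℝ => w⁻¹) w := continuousAt_inv₀ h.ne'
      exact (ContinuousAt.comp (f := fun w : ℝ => w⁻¹) hf.continuousAt hi).mul
        (hi.rpow_const (Or.inl (inv_ne_zero h.ne')))
  obtain ⟨p, hp⟩ := exists_polynomial_near_of_continuousOn 0 x⁻¹ _ hc ε hε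
  refine ⟨p.natDegree + 1, p.coeff, fun z hz => ?_⟩
  have hz0 : 0 < z := hx.trans hz
  have hzx : x < z := hz
  have h := hp z⁻¹ ⟨by positivity, by gcongr⟩
  rw [inv_inv, Polynomial.eval_eq_sum_range] at h
  have hpos := Real.rpow_pos_of_pos hz0 s
  have e : f z - ∑ i ∈ Finset.range (p.natDegree + 1), p.coeff i * z ^ (-(s + i)) =
      -((∑ i ∈ Finset.range (p.natDegree + 1), p.coeff i * z⁻¹ ^ i - f z * z ^ s) * z ^ (-s)) := by
    rw [sub_mul, Finset.sum_mul]
    have : ∀ i : ℕ, p.coeff i * z⁻¹ ^ i * z ^ (-s) = p.coeff i * z ^ (-(s + i)) := fun i => by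
      rw [neg_add, Real.rpow_add hz0, Real.rpow_neg hz0.le (i:ℝ), Real.rpow_natCast, inv_pow]; ring
    simp_rw [this]
    rw [Real.rpow_neg hz0.le s]
    field_simp
    ring
  rw [e, abs_neg, abs_mul, abs_of_pos (Real.rpow_pos_of_pos hz0 (-s))]
  have := Real.rpow_pos_of_pos hz0 (-s)
  gcongr

theorem IB_semigroup (ν α β : ℝ) (hν : 0 ≤ ν) (hα : 0 < α) (hβ : 0 < β)
    (f : ℝ → ℝ) (hf : ContDiff ℝ (⊤ : ℕ∞) f) (hsupp : HasCompactSupport f)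
    (hsupp' : tsupport f ⊆ Ioi (0 : ℝ)) :
    ∀ x : ℝ, 0 < x → IB ν α (IB ν β f) x = IB ν (α + β) f x := by
  intro x hx
  set μ := (ν - 1) / 2 with hμ
  obtain ⟨s, hsdef⟩ : ∃ s : ℝ, s = 2 * (2 * α + 2 * β + |μ| + 1) := ⟨_, rfl⟩
  have hα1 := abs_add_le α μ
  have hβ1 := abs_add_le β μ
  have hαβ1 := abs_add_le (α + β) μ
  rw [abs_of_pos hα] at hα1
  rw [abs_of_pos hβ] at hβ1
  rw [abs_of_pos (add_pos hα hβ)] at hαβ1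
  have hμ1 := le_abs_self μ
  have hμ2 := abs_nonneg μ
  have hsβ : |β + μ| + β < s / 2 := by linarith
  have hsα : |α + μ| + α < (s - 2 * β) / 2 := by linarith
  have hsαβ : |α + β + μ| + (α + β) < s / 2 := by linarith
  have hn : ∀ i : ℕ, (0:ℝ) ≤ i := fun i => Nat.cast_nonneg i
  obtain ⟨Mβ, -, hMβ⟩ := kk_abs ν β s hβ
  obtain ⟨Mα, -, hMα⟩ := kk_abs ν α (s - 2 * β) hα
  obtain ⟨Mγ, -, hMγ⟩ := kk_abs ν (α + β) s (add_pos hα hβ)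
  have hfc : Continuous f := hf.continuous
  -- the inner function is close to power sums
  have inner : ∀ ε > 0, ∀ (N : ℕ) (c : ℕ → ℝ), (∀ z ∈ Ioi x,
      |f z - ∑ i ∈ Finset.range N, c i * z ^ (-(s + i))| ≤ ε * z ^ (-s)) → ∀ y ∈ Ioi x,
      |IB ν β f y - ∑ i ∈ Finset.range N, (c i * mm ν β (s + i)) * y ^ (-(s + i - 2 * β))| ≤
        (ε * Mβ) * y ^ (-(s - 2 * β)) := by
    intro ε hε N c hc y hy
    have hy0 : 0 < y := hx.trans hy
    have := IB_close ν β s hβ hsβ Mβ hMβ y hy0 f hfc.aestronglyMeasurable ε N c (fun i => s + i)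
      (fun i => by linarith [hn i]) (fun z hz => hc z (mem_Ioi.2 (lt_trans (mem_Ioi.1 hy) (mem_Ioi.1 hz))))
    simpa only [mul_assoc, neg_sub] using this
  have hgm : AEStronglyMeasurable (IB ν β f) (volume.restrict (Ioi x)) := by
    choose N c hNc using fun n : ℕ => approx f hfc hsupp hsupp' x hx s (1 / ((n:ℝ) + 1)) (by positivity)
    refine aestronglyMeasurable_of_tendsto_ae Filter.atTop
      (f := fun n y => ∑ i ∈ Finset.range (N n), (c n i * mm ν β (s + i)) * y ^ (-(s + i - 2 * β)))
      (fun n => (by fun_prop : Measurable fun y : ℝ => ∑ i ∈ Finset.range (N n),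
        (c n i * mm ν β (s + i)) * y ^ (-(s + i - 2 * β))).aestronglyMeasurable) ?_
    refine ae_restrict_of_forall_mem measurableSet_Ioi fun y hy => ?_
    rw [tendsto_iff_norm_sub_tendsto_zero]
    refine squeeze_zero (fun n => norm_nonneg _) (fun n => ?_)
      (g := fun n : ℕ => 1 / ((n:ℝ) + 1) * (Mβ * y ^ (-(s - 2 * β)))) ?_
    · rw [norm_sub_rev, Real.norm_eq_abs, ← mul_assoc]
      exact inner _ (by positivity) _ _ (hNc n) y hy
    · simpa using (tendsto_one_div_add_atTop_nhds_zero_nat (𝕜 := ℝ)).mul_const (Mβ * y ^ (-(s - 2 * β)))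
  have main : ∀ ε > 0, |IB ν α (IB ν β f) x - IB ν (α + β) f x| ≤
      ε * (Mβ * (Mα * x ^ (2 * α - (s - 2 * β))) + Mγ * x ^ (2 * (α + β) - s)) := by
    intro ε hε
    obtain ⟨N, c, hc⟩ := approx f hfc hsupp hsupp' x hx s ε hε
    have h1 := IB_close ν α (s - 2 * β) hα hsα Mα hMα x hx (IB ν β f) hgm (ε * Mβ) N
      (fun i => c i * mm ν β (s + i)) (fun i => s + i - 2 * β) (fun i => by linarith [hn i])
      (inner ε hε N c hc)
    have h2 := IB_close ν (α + β) s (add_pos hα hβ) hsαβ Mγ hMγ x hx f hfc.aestronglyMeasurable ε N c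
      (fun i => s + i) (fun i => by linarith [hn i]) hc
    have e : ∑ i ∈ Finset.range N, c i * mm ν β (s + i) *
        (mm ν α (s + i - 2 * β) * x ^ (2 * α - (s + i - 2 * β))) =
        ∑ i ∈ Finset.range N, c i * (mm ν (α + β) (s + i) * x ^ (2 * (α + β) - (s + i))) := by
      refine Finset.sum_congr rfl fun i _ => ?_
      rw [← mm_mul ν α β (s + i) (by linarith [hn i]) (by linarith [hn i]),
        show 2 * α - (s + i - 2 * β) = 2 * (α + β) - (s + i) by ring]
      ring
    rw [e] at h1
    rw [abs_le] at h1 h2 ⊢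
    constructor <;> linarith [h1.1, h1.2, h2.1, h2.2]
  have hlim : Filter.Tendsto (fun n : ℕ => 1 / ((n:ℝ) + 1) *
      (Mβ * (Mα * x ^ (2 * α - (s - 2 * β))) + Mγ * x ^ (2 * (α + β) - s))) Filter.atTop (nhds 0) := by
    simpa using (tendsto_one_div_add_atTop_nhds_zero_nat (𝕜 := ℝ)).mul_const
      (Mβ * (Mα * x ^ (2 * α - (s - 2 * β))) + Mγ * x ^ (2 * (α + β) - s))
  have := ge_of_tendsto' hlim fun n => main _ (by positivity)
  exact sub_eq_zero.1 (abs_eq_zero.1 (le_antisymm this (abs_nonneg _)))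
end
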